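/- Let I = Borel(M,N) be a two-Borel ideal and let μ be a monomial. If →Γ_μ(I) has a sink of type N, then Γ_μ(I) has no vertex of type M; that is, μ admits no factorization μ = w_1⋯w_t with every w_i a minimal generator of I and some w_i ∈ G_M. -/

import Mathlib

/-!  Monomials in `K[x_1,…,x_n]` are identified with their exponent vectors in `Fin n → ℕ`
(`0`-based indexing: `x_1` corresponds to index `0`).  -/

variable {n : ℕ}

/-- Cumulative exponent vector (`0`-based): `cexp m i = m i + m (i+1) + ⋯ + m (n-1)`,
so `cexp m i` is the paper's `σ_{i+1}(m)`, and `cexp m n = 0` is the convention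
`σ_{n+1}(m) = 0`. -/
def cexp (m : Fin n → ℕ) (i : ℕ) : ℕ :=
  ∑ k : Fin n, if i ≤ (k : ℕ) then m k else 0

/-- `mshift m src tgt` is the exponent vector of `(x_tgt / x_src) · m` (only used when
`src ≠ tgt` and `x_src` divides `m`).  Thus `mshift m j i` is the Borel move `B_{j→i}(m)`
(for `i < j`) and `mshift m i j` is the reverse Borel move `RB_{i→j}(m)` (for `i < j`). -/
def mshift (m : Fin n → ℕ) (src tgt : Fin n) : Fin n → ℕ :=
  fun k => if k = tgt then m tgt + 1 else if k = src then m src - 1 else m k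

/-- `BorelStep a b` : `b` is obtained from `a` by a single Borel move `B_{j→i}`, `i < j`. -/
def BorelStep (a b : Fin n → ℕ) : Prop :=
  ∃ i j : Fin n, i < j ∧ 0 < a j ∧ b = mshift a j i

/-- `InBorel m m'` : `m ∈ Borel(m')`, i.e. `m` is obtained from `m'` by a finite (possibly
empty) sequence of Borel moves. -/
def InBorel (m m' : Fin n → ℕ) : Prop := Relation.ReflTransGen BorelStep m' m

/-- Divisibility of monomials: `m` divides `μ`. -/
def mDvd (m μ : Fin n → ℕ) : Prop := ∀ k, m k ≤ μ k

/-- `mLexLt m m'` : `m` is lexicographically smaller than `m'` (lex order with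
`x_1 > x_2 > ⋯ > x_n`); i.e. `m` comes *later* than `m'` in the lex listing of monomials. -/
def mLexLt (m m' : Fin n → ℕ) : Prop :=
  ∃ i : Fin n, (∀ k, k < i → m k = m' k) ∧ m i < m' i

/-- Total degree of a monomial. -/
def mDeg (m : Fin n → ℕ) : ℕ := ∑ k, m k

/-- A vertex of the fiber graph `Γ_μ(I)`, where `G` is the minimal monomial generating set of
`I`: a multiset of elements of `G` whose product (sum of exponent vectors) is `μ`. -/
def FiberVertex (G : Set (Fin n → ℕ)) (μ : Fin n → ℕ) (Z : Multiset (Fin n → ℕ)) : Prop :=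
  (∀ w ∈ Z, w ∈ G) ∧ Z.sum = μ

/-- Adjacency in the fiber graph `Γ_μ(I)`: `Z` is obtained from `Z'` by applying a Borel move
`B_{j→i}` to one element and the corresponding reverse Borel move `RB_{i→j}` to another,
leaving all other elements unchanged. -/
def FiberAdj (G : Set (Fin n → ℕ)) (μ : Fin n → ℕ) (Z Z' : Multiset (Fin n → ℕ)) : Prop :=
  FiberVertex G μ Z ∧ FiberVertex G μ Z' ∧
  ∃ (W : Multiset (Fin n → ℕ)) (u v u' v' : Fin n → ℕ) (i j : Fin n),
    i < j ∧ Z = u ::ₘ v ::ₘ W ∧ Z' = u' ::ₘ v' ::ₘ W ∧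
    0 < u' j ∧ u = mshift u' j i ∧ 0 < v' i ∧ v = mshift v' i j

/-- `G_M`: the minimal monomial generators of `Borel(M)`, i.e. (for the equigenerated Borel
ideal `I = Borel(M,N)`) the degree-`d` monomials in `Borel(M)`. -/
def gensM (M : Fin n → ℕ) : Set (Fin n → ℕ) := {w | InBorel w M}

/-- `G_N = gens(I) ∖ G_M` for `I = Borel(M,N)`. -/
def gensN (M N : Fin n → ℕ) : Set (Fin n → ℕ) := {w | InBorel w N ∧ ¬ InBorel w M}

/-- The minimal monomial generating set `G` of the two-Borel ideal `I = Borel(M,N)`. -/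
def gens2 (M N : Fin n → ℕ) : Set (Fin n → ℕ) := {w | InBorel w M ∨ InBorel w N}

/-- The fiber sink variable order: `varBefore M N w₁ w₂` says the variable `Y_{w₁}` comes
(strictly) before `Y_{w₂}`.  First come the `w ∈ G_N`, with `Y_N` first (lex-smaller `w`
first), then the `w ∈ G_M`, with `Y_M` last (lex-larger `w` first). -/
def varBefore (M N : Fin n → ℕ) (w₁ w₂ : Fin n → ℕ) : Prop :=
  (w₁ ∈ gensN M N ∧ w₂ ∈ gensM M) ∨
  (w₁ ∈ gensN M N ∧ w₂ ∈ gensN M N ∧ mLexLt w₁ w₂) ∨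
  (w₁ ∈ gensM M ∧ w₂ ∈ gensM M ∧ mLexLt w₂ w₁)

/-- The fiber sink order (reverse lexicographic order induced by the fiber sink variable
order): `laterThan M N Z Z'` says the monomial `∏_{w ∈ Z} Y_w` comes strictly *later* than
`∏_{w ∈ Z'} Y_w`; i.e. at the last variable (in the fiber sink variable order) where the two
multisets have different multiplicities, `Z` has the larger multiplicity. -/
def laterThan (M N : Fin n → ℕ) (Z Z' : Multiset (Fin n → ℕ)) : Prop :=
  ∃ w, Z'.count w < Z.count w ∧ ∀ u, varBefore M N w u → Z.count u = Z'.count u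

/-- A sink of the directed fiber graph `→Γ_μ(I)` for `I = Borel(M,N)` (edges are directed
toward the endpoint that is later in the fiber sink order): a vertex that is later than all
of its neighbors. -/
def IsSink (M N μ : Fin n → ℕ) (Z : Multiset (Fin n → ℕ)) : Prop :=
  FiberVertex (gens2 M N) μ Z ∧
  ∀ Z', FiberAdj (gens2 M N) μ Z Z' → Z' ≠ Z → laterThan M N Z Z'

theorem cexp_add (a b : Fin n → ℕ) (k : ℕ) : cexp (a + b) k = cexp a k + cexp b k := by
  unfold cexp
  rw [← Finset.sum_add_distrib]
  refine Finset.sum_congr rfl fun x _ => ?_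
  split_ifs <;> simp

theorem cexp_single (j : Fin n) (k : ℕ) :
    cexp (Pi.single j 1 : Fin n → ℕ) k = if k ≤ (j : ℕ) then 1 else 0 := by
  unfold cexp
  rw [Finset.sum_eq_single j]
  · simp
  · intro b _ hb
    simp [hb]
  · simp

theorem mshift_add (a : Fin n → ℕ) (i j : Fin n) (hij : i ≠ j) (hj : 0 < a j) :
    mshift a j i + Pi.single j 1 = a + Pi.single i 1 := by
  funext k
  simp only [mshift, Pi.add_apply, Pi.single_apply]
  split_ifs <;> subst_vars <;> first | contradiction | omega

theorem mshift_mshift (a : Fin n → ℕ) (i j : Fin n) (hij : i ≠ j) (hj : 0 < a j) :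
    mshift (mshift a j i) i j = a := by
  funext k
  simp only [mshift]
  split_ifs <;> subst_vars <;> first | contradiction | (simp_all; done) | (simp_all; omega)

theorem cexp_mshift (a : Fin n → ℕ) (i j : Fin n) (hij : i ≠ j) (hj : 0 < a j) (k : ℕ) :
    cexp (mshift a j i) k + (if k ≤ (j : ℕ) then 1 else 0)
      = cexp a k + (if k ≤ (i : ℕ) then 1 else 0) := by
  rw [← cexp_single, ← cexp_single, ← cexp_add, ← cexp_add, mshift_add a i j hij hj]

theorem cexp_succ (m : Fin n → ℕ) (k : Fin n) : cexp m k = m k + cexp m (k + 1) := by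
  unfold cexp
  rw [← Finset.add_sum_erase _ _ (Finset.mem_univ k),
    ← Finset.add_sum_erase (f := fun x : Fin n => if (k : ℕ) + 1 ≤ (x : ℕ) then m x else 0) _
      (Finset.mem_univ k)]
  simp only [le_refl, if_true]
  have : ¬ ((k : ℕ) + 1 ≤ (k : ℕ)) := by omega
  simp only [this, if_false, zero_add]
  congr 1
  refine Finset.sum_congr rfl fun x hx => ?_
  have : (x : ℕ) ≠ k := fun h => (Finset.ne_of_mem_erase hx) (Fin.ext h)
  split_ifs <;> first | rfl | omega

theorem cexp_ge (m : Fin n → ℕ) (k : ℕ) (hk : n ≤ k) : cexp m k = 0 := by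
  unfold cexp
  refine Finset.sum_eq_zero fun x _ => ?_
  rw [if_neg]; omega

theorem cexp_anti (m : Fin n → ℕ) {k l : ℕ} (h : k ≤ l) : cexp m l ≤ cexp m k := by
  unfold cexp
  refine Finset.sum_le_sum fun x _ => ?_
  split_ifs <;> omega

theorem cexp_eq_of_zero (m : Fin n → ℕ) {k l : ℕ} (h : k ≤ l)
    (hz : ∀ x : Fin n, k ≤ (x : ℕ) → (x : ℕ) < l → m x = 0) : cexp m k = cexp m l := by
  unfold cexp
  refine Finset.sum_congr rfl fun x _ => ?_
  split_ifs
  · rfl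
  · exact hz x (by assumption) (by omega)
  · omega
  · rfl

theorem cexp_zero (m : Fin n → ℕ) : cexp m 0 = mDeg m := by
  simp [cexp, mDeg]

theorem inBorel_cexp {w M : Fin n → ℕ} (h : InBorel w M) :
    mDeg w = mDeg M ∧ ∀ k, cexp w k ≤ cexp M k := by
  unfold InBorel at h
  induction h with
  | refl => exact ⟨rfl, fun _ => le_rfl⟩
  | tail _ hs ih =>
    obtain ⟨i, j, hij, hj, rfl⟩ := hs
    have key := cexp_mshift _ i j hij.ne hj
    have hij' : (i : ℕ) < j := hij
    refine ⟨?_, fun k => ?_⟩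
    · have := key 0
      simp only [cexp_zero, Nat.zero_le, if_true] at this
      omega
    · have h1 := key k
      have h2 := ih.2 k
      split_ifs at h1 <;> omega

/-- The largest index at which a strict inequality of cumulative exponents holds. -/
theorem exists_last (a b : Fin n → ℕ) (k : ℕ) (hk : cexp a k < cexp b k) :
    ∃ j : Fin n, k ≤ j ∧ cexp a j < cexp b j ∧ 0 < b j ∧ ∀ l, (j : ℕ) < l → cexp b l ≤ cexp a l := by
  classical
  have hex : ∃ l, l ≤ n ∧ ∀ l', l ≤ l' → cexp b l' ≤ cexp a l' :=
    ⟨n, le_rfl, fun l' h => by rw [cexp_ge b l' h]; exact Nat.zero_le _⟩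
  obtain ⟨hln, hl⟩ := Nat.find_spec hex
  have hmin := fun m => @Nat.find_min _ _ hex m
  generalize Nat.find hex = l at *
  have hkl : k < l := by
    by_contra h
    have := hl k (by omega)
    omega
  obtain ⟨p, rfl⟩ : ∃ p, l = p + 1 := ⟨l - 1, by omega⟩
  have hp : cexp a p < cexp b p := by
    by_contra h
    refine hmin p (by omega) ⟨by omega, fun l' hl' => ?_⟩
    rcases Nat.eq_or_lt_of_le hl' with rfl | h'
    · omega
    · exact hl l' h'
  refine ⟨⟨p, by omega⟩, by simp; omega, hp, ?_, fun l' h' => hl l' h'⟩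
  have h1 := cexp_succ a ⟨p, by omega⟩
  have h2 := cexp_succ b ⟨p, by omega⟩
  have h3 := hl (p + 1) le_rfl
  simp only at h1 h2
  omega

theorem inBorel_of_cexp (w : Fin n → ℕ) : ∀ (s : ℕ) (M : Fin n → ℕ),
    mDeg w = mDeg M → (∀ k, cexp w k ≤ cexp M k) →
    (∑ k : Fin n, (cexp M k - cexp w k)) = s → InBorel w M := by
  intro s
  induction s with
  | zero =>
    intro M hd h hs
    have : w = M := by
      have heq : ∀ k, cexp M k = cexp w k := by
        intro k
        by_cases hk : k < n
        · rw [Finset.sum_eq_zero_iff] at hs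
          have h1 := hs ⟨k, hk⟩ (Finset.mem_univ _)
          have h2 := h k
          simp only at h1
          omega
        · rw [cexp_ge _ _ (by omega), cexp_ge _ _ (by omega)]
      funext k
      have h1 := cexp_succ w k
      have h2 := cexp_succ M k
      rw [heq, heq] at h2
      omega
    subst this
    exact Relation.ReflTransGen.refl
  | succ s ih =>
    intro M hd h hs
    have : ∃ k : Fin n, cexp w k < cexp M k := by
      by_contra hc
      push Not at hc
      have : (∑ k : Fin n, (cexp M k - cexp w k)) = 0 :=
        Finset.sum_eq_zero fun x _ => by have := hc x; omega
      omega
    obtain ⟨k, hk⟩ := this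
    obtain ⟨j, -, hj, hMj, -⟩ := exists_last w M k hk
    have hj0 : (j : ℕ) ≠ 0 := by
      intro h0
      rw [h0, cexp_zero, cexp_zero] at hj
      omega
    let i : Fin n := ⟨j - 1, by omega⟩
    have hiv : (i : ℕ) = j - 1 := rfl
    have hij : i < j := by
      rw [Fin.lt_def]; omega
    have key := cexp_mshift M i j hij.ne hMj
    have hne : ∀ k : ℕ, k ≠ j → cexp (mshift M j i) k = cexp M k := by
      intro k hk
      have := key k
      split_ifs at this <;> omega
    have hje : cexp (mshift M j i) j + 1 = cexp M j := by
      have := key j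
      split_ifs at this <;> omega
    have hB : InBorel w (mshift M j i) := by
      apply ih
      · rw [hd, ← cexp_zero, ← cexp_zero, hne 0 (Ne.symm hj0)]
      · intro k
        by_cases hk : k = j
        · subst hk; omega
        · rw [hne k hk]; exact h k
      · rw [← Finset.add_sum_erase _ _ (Finset.mem_univ j)] at hs ⊢
        have : ∑ x ∈ Finset.univ.erase j, (cexp (mshift M j i) x - cexp w x)
            = ∑ x ∈ Finset.univ.erase j, (cexp M x - cexp w x) := by
          refine Finset.sum_congr rfl fun x hx => ?_
          rw [hne x fun h => (Finset.ne_of_mem_erase hx) (Fin.ext h)]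
        rw [this]
        omega
    exact Relation.ReflTransGen.head ⟨i, j, hij, hMj, rfl⟩ hB

theorem mem_borel {w M : Fin n → ℕ} (hd : mDeg w = mDeg M) (h : ∀ k, cexp w k ≤ cexp M k) :
    InBorel w M := inBorel_of_cexp w _ M hd h rfl

theorem cexp_sum (Z : Multiset (Fin n → ℕ)) (k : ℕ) :
    cexp Z.sum k = (Z.map fun w => cexp w k).sum := by
  induction Z using Multiset.induction with
  | empty => simp [cexp]
  | cons a Z ih => simp [cexp_add, ih]

theorem exists_lex_max (Z : Multiset (Fin n → ℕ)) (hZ : Z ≠ 0) :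
    ∃ u ∈ Z, ∀ w ∈ Z, w = u ∨ mLexLt w u := by
  classical
  obtain ⟨a, ha⟩ := Multiset.exists_mem_of_ne_zero hZ
  obtain ⟨u, hu, hmax⟩ := Z.toFinset.exists_max_image (fun w => toLex w)
    ⟨a, Multiset.mem_toFinset.2 ha⟩
  refine ⟨u, Multiset.mem_toFinset.1 hu, fun w hw => ?_⟩
  rcases (hmax w (Multiset.mem_toFinset.2 hw)).eq_or_lt with h | h
  · exact Or.inl (toLex.injective h)
  · exact Or.inr h

theorem mLexLt_trans {a b c : Fin n → ℕ} (h1 : mLexLt a b) (h2 : mLexLt b c) : mLexLt a c := by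
  have h1' : toLex a < toLex b := h1
  have h2' : toLex b < toLex c := h2
  exact (h1'.trans h2' : toLex a < toLex c)

theorem mLexLt_irrefl (a : Fin n → ℕ) : ¬ mLexLt a a := by
  rintro ⟨i, -, h⟩
  exact lt_irrefl _ h

theorem sum_le_card (Z : Multiset (Fin n → ℕ)) (k c : ℕ) (h : ∀ w ∈ Z, cexp w k ≤ c) :
    (Z.map fun w => cexp w k).sum ≤ Z.card * c := by
  induction Z using Multiset.induction with
  | empty => simp
  | cons a Z ih =>
    simp only [Multiset.map_cons, Multiset.sum_cons, Multiset.card_cons]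
    have h1 := h a (by simp)
    have h2 := ih fun w hw => h w (by simp [hw])
    linarith

theorem sum_eq_card (Z : Multiset (Fin n → ℕ)) (k c : ℕ) (h : ∀ w ∈ Z, cexp w k = c) :
    (Z.map fun w => cexp w k).sum = Z.card * c := by
  rw [Multiset.map_congr rfl h]
  simp

/-- In a type-`N` sink, every element other than a lex-largest element `u` is tight
at each index of the support of `u`. -/
theorem tight_of_sink (M N μ : Fin n → ℕ) (u w : Fin n → ℕ) (W : Multiset (Fin n → ℕ))
    (hs : IsSink M N μ (w ::ₘ u ::ₘ W))
    (hN : ∀ x ∈ w ::ₘ u ::ₘ W, x ∈ gensN M N)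
    (hmax : ∀ x ∈ w ::ₘ u ::ₘ W, x = u ∨ mLexLt x u)
    (j : Fin n) (hj : 0 < u j) : cexp w j = cexp N j := by
  classical
  have hwN := hN w (by simp)
  have huN := hN u (by simp)
  obtain ⟨hwd, hwc⟩ := inBorel_cexp hwN.1
  by_contra hne
  have hlt : cexp w j < cexp N j := lt_of_le_of_ne (hwc j) hne
  have hex : ∃ i : Fin n, i < j ∧ 0 < w i ∧ ∀ x : Fin n, i < x → x < j → w x = 0 := by
    by_cases hS : (Finset.univ.filter fun i : Fin n => i < j ∧ 0 < w i).Nonempty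
    · obtain ⟨i, hi, him⟩ := Finset.exists_max_image _ (fun x => x) hS
      simp only [Finset.mem_filter, Finset.mem_univ, true_and] at hi him
      refine ⟨i, hi.1, hi.2, fun x hx hxj => ?_⟩
      by_contra h0
      exact absurd (him x ⟨hxj, Nat.pos_of_ne_zero h0⟩) (not_le.2 hx)
    · exfalso
      have : cexp w 0 = cexp w j := by
        refine cexp_eq_of_zero w (Nat.zero_le _) fun x _ hx => ?_
        by_contra h0
        exact hS ⟨x, by simpa using ⟨hx, Nat.pos_of_ne_zero h0⟩⟩
      have h2 := cexp_anti N (Nat.zero_le (j : ℕ))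
      rw [cexp_zero] at this h2
      omega
  obtain ⟨i, hij, hwi, hz⟩ := hex
  have hij' : (i : ℕ) < j := hij
  have hw' : InBorel (mshift w i j) N := by
    have key := cexp_mshift w j i hij.ne' hwi
    apply mem_borel
    · have := key 0
      simp only [cexp_zero, Nat.zero_le, if_true] at this
      omega
    · intro k
      have h1 := key k
      have h2 := hwc k
      by_cases hk : (i : ℕ) < k ∧ k ≤ j
      · have h3 : cexp w k = cexp w j := cexp_eq_of_zero w hk.2 fun x hx hxj =>
          hz x (by rw [Fin.lt_def]; omega) hxj
        have h4 := cexp_anti N hk.2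
        split_ifs at h1 <;> omega
      · split_ifs at h1 <;> omega
  have hu' : InBorel (mshift u j i) N := huN.1.tail ⟨i, j, hij, hj, rfl⟩
  have hlex : mLexLt u (mshift u j i) := by
    refine ⟨i, fun k hk => ?_, by simp [mshift]⟩
    simp [mshift, hk.ne, (hk.trans hij).ne]
  have hnot : mshift u j i ∉ w ::ₘ u ::ₘ W := by
    intro h
    rcases hmax _ h with h | h
    · rw [h] at hlex; exact mLexLt_irrefl _ hlex
    · exact mLexLt_irrefl _ (mLexLt_trans hlex h)
  have hadj : FiberAdj (gens2 M N) μ (w ::ₘ u ::ₘ W)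
      (mshift w i j ::ₘ mshift u j i ::ₘ W) := by
    refine ⟨hs.1, ⟨?_, ?_⟩, W, w, u, mshift w i j, mshift u j i, i, j, hij, rfl, rfl, ?_, ?_, ?_, ?_⟩
    · intro x hx
      simp only [Multiset.mem_cons] at hx
      rcases hx with rfl | rfl | hx
      · exact Or.inr hw'
      · exact Or.inr hu'
      · exact hs.1.1 x (by simp [hx])
    · rw [← hs.1.2]
      simp only [Multiset.sum_cons]
      have h1 := mshift_add u i j hij.ne hj
      have h2 := mshift_add w j i hij.ne' hwi
      funext k
      have h1 := congrFun h1 k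
      have h2 := congrFun h2 k
      simp only [Pi.add_apply] at h1 h2 ⊢
      omega
    · simp [mshift]
    · exact (mshift_mshift w j i hij.ne' hwi).symm
    · simp [mshift]
    · exact (mshift_mshift u i j hij.ne hj).symm
  have hneq : (mshift w i j ::ₘ mshift u j i ::ₘ W) ≠ (w ::ₘ u ::ₘ W) := by
    intro h
    apply hnot
    rw [← h]
    simp
  obtain ⟨x, hx, hxe⟩ := hs.2 _ hadj hneq
  have hxZ : x ∈ w ::ₘ u ::ₘ W := Multiset.count_pos.1 (by omega)
  have hb : varBefore M N x (mshift u j i) := by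
    by_cases hM : InBorel (mshift u j i) M
    · exact Or.inl ⟨hN x hxZ, hM⟩
    · refine Or.inr (Or.inl ⟨hN x hxZ, ⟨hu', hM⟩, ?_⟩)
      rcases hmax x hxZ with rfl | h
      · exact hlex
      · exact mLexLt_trans h hlex
  have h1 := hxe _ hb
  rw [Multiset.count_eq_zero_of_notMem hnot] at h1
  have h2 : 0 < Multiset.count (mshift u j i) (mshift w i j ::ₘ mshift u j i ::ₘ W) :=
    Multiset.count_pos.2 (by simp)
  omega

/-- Let `I = Borel(M,N)` be a two-Borel ideal and `μ` a monomial.  If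
`→Γ_μ(I)` has a sink of type `N`, then `Γ_μ(I)` has no vertex of type `M`: every
factorization of `μ` into minimal generators of `I` uses only elements of `G_N`. -/
theorem statement14 (M N μ : Fin n → ℕ) (d : ℕ) (hMd : mDeg M = d) (hNd : mDeg N = d)
    (hlex : mLexLt N M)
    (hsink : ∃ Z, IsSink M N μ Z ∧ ∀ w ∈ Z, w ∈ gensN M N) :
    ∀ Z, FiberVertex (gens2 M N) μ Z → ∀ w ∈ Z, w ∈ gensN M N := by
  classical
  obtain ⟨Z, hs, hN⟩ := hsink
  intro Y hY
  have hdpos : 0 < d := by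
    obtain ⟨i, -, h⟩ := hlex
    have : M i ≤ mDeg M := Finset.single_le_sum (f := M) (fun _ _ => Nat.zero_le _) (Finset.mem_univ i)
    omega
  have hdeg : ∀ w ∈ gens2 M N, cexp w 0 = d := by
    rintro w (h | h)
    · rw [cexp_zero, (inBorel_cexp h).1, hMd]
    · rw [cexp_zero, (inBorel_cexp h).1, hNd]
  have hcard : Y.card = Z.card := by
    have h1 := sum_eq_card Y 0 d fun w hw => hdeg w (hY.1 w hw)
    have h2 := sum_eq_card Z 0 d fun w hw => hdeg w (hs.1.1 w hw)
    rw [← cexp_sum, hY.2] at h1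
    rw [← cexp_sum, hs.1.2, h1] at h2
    exact Nat.eq_of_mul_eq_mul_right hdpos h2
  intro y hy
  by_contra hyN
  have hyM : InBorel y M := by
    by_contra h
    exact hyN ⟨(hY.1 y hy).resolve_left h, h⟩
  have hZ : Z ≠ 0 := by
    intro h
    have : 0 < Y.card := Multiset.card_pos_iff_exists_mem.2 ⟨y, hy⟩
    rw [hcard, h] at this
    simp at this
  obtain ⟨u, hu, hmax⟩ := exists_lex_max Z hZ
  have huN := hN u hu
  have hex : ∃ k, cexp M k < cexp u k := by
    by_contra h
    push Not at h
    exact huN.2 (mem_borel (by rw [(inBorel_cexp huN.1).1, hNd, hMd]) h)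
  obtain ⟨k, hk⟩ := hex
  obtain ⟨j, -, hj, huj, -⟩ := exists_last M u k hk
  have hjN := (inBorel_cexp huN.1).2 j
  obtain ⟨V, rfl⟩ := Multiset.exists_cons_of_mem hu
  obtain ⟨X, rfl⟩ := Multiset.exists_cons_of_mem hy
  have htight : ∀ w ∈ V, cexp w j = cexp N j := by
    intro w hw
    obtain ⟨W, rfl⟩ := Multiset.exists_cons_of_mem hw
    rw [Multiset.cons_swap] at hs hN hmax
    exact tight_of_sink M N μ u w W hs hN hmax j huj
  have h1 := sum_eq_card V j _ htight
  have h2 : (X.map fun w => cexp w j).sum ≤ X.card * cexp N j := by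
    refine sum_le_card X j _ fun w hw => ?_
    rcases hY.1 w (by simp [hw]) with h | h
    · have := (inBorel_cexp h).2 j
      omega
    · exact (inBorel_cexp h).2 j
  have h3 := cexp_sum (u ::ₘ V) j
  have h4 := cexp_sum (y ::ₘ X) j
  have h5 := (inBorel_cexp hyM).2 j
  rw [hs.1.2] at h3
  rw [hY.2] at h4
  simp only [Multiset.map_cons, Multiset.sum_cons, Multiset.card_cons] at h3 h4 hcard
  have h6 : X.card = V.card := by omega
  rw [h6] at h2
  omega
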